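/- arXiv:2408.07139 — 3 statements merged into one kernel-verified Lean document; each statement's English description precedes it below -/
import Mathlib

section
/- Let N ≥ 2 and let c : {1,…,N−1} → (0,∞) be conductances. For every x ∈ {2,…,N+1}, the map λ ↦ θ(λ,x) is continuous and strictly increasing on (0,∞). -/
open OnePoint

/-- `Tan θ ∈ ℝ̄ = ℝ ∪ {∞}`: `tan θ` if `cos θ ≠ 0`, and `∞` if `cos θ = 0`. -/
noncomputable def Tan (θ : ℝ) : OnePoint ℝ :=
  if Real.cos θ = 0 then ∞ else (Real.tan θ : OnePoint ℝ)

/-- The map `Ξ^c(λ, ·) : ℝ̄ → ℝ̄`: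
`Ξ^c(λ,b) = b/(1 − b/c) + λ` for real `b ≠ c`, `Ξ^c(λ,c) = ∞`, `Ξ^c(λ,∞) = λ − c`. -/
noncomputable def Xi (c lam : ℝ) (b : OnePoint ℝ) : OnePoint ℝ :=
  OnePoint.rec ((lam - c : ℝ) : OnePoint ℝ)
    (fun b => if b = c then ∞ else ((b / (1 - b / c) + lam : ℝ) : OnePoint ℝ)) b

/-- `I(λ,c)`: the convex hull of the set of real fixed points of `b ↦ Ξ^c(λ,b)`. -/
noncomputable def Iset (lam c : ℝ) : Set ℝ :=
  if 4 * c ≤ lam then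
    Set.Icc ((lam - Real.sqrt (lam ^ 2 - 4 * lam * c)) / 2)
      ((lam + Real.sqrt (lam ^ 2 - 4 * lam * c)) / 2)
  else ∅

/-- The indicator `1_{I(λ,c)}` on `ℝ̄`, with `1_{I(λ,c)}(∞) := 0`. -/
noncomputable def indI (lam c : ℝ) (b : OnePoint ℝ) : ℝ :=
  OnePoint.rec 0 (fun x => (Iset lam c).indicator (fun _ => (1 : ℝ)) x) b

/-- The angle mapping
`φ(c,λ,θ) = inf {θ' : θ' ≥ θ + π·1_{I(λ,c)}(Tan θ), Tan θ' = Ξ^c(λ, Tan θ)}`. -/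
noncomputable def phi (c lam θ : ℝ) : ℝ :=
  sInf {θ' : ℝ | θ + Real.pi * indI lam c (Tan θ) ≤ θ' ∧ Tan θ' = Xi c lam (Tan θ)}

/-- The angle sequence `θ(λ, x)`, `1 ≤ x ≤ N+1`: `θ(λ,1) = 0`, `θ(λ,2) = arctan λ`,
and `θ(λ,x+1) = φ(c(x−1), λ, θ(λ,x))` for `2 ≤ x ≤ N`. -/
noncomputable def thetaSeq (c : ℕ → ℝ) (lam : ℝ) : ℕ → ℝ
  | 0 => 0
  | 1 => 0
  | 2 => Real.arctan lam
  | x + 3 => phi (c (x + 1)) lam (thetaSeq c lam (x + 2))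


/-- lift of the shear `(u,v) ↦ (u, v + t u)` to angles -/
noncomputable def shA (t θ : ℝ) : ℝ :=
  θ + Complex.arg ⟨1 + t * (Real.sin θ * Real.cos θ), t * Real.cos θ ^ 2⟩

lemma shA_ne (t θ : ℝ) :
    (⟨1 + t * (Real.sin θ * Real.cos θ), t * Real.cos θ ^ 2⟩ : ℂ) ∈ Complex.slitPlane := by
  rw [Complex.mem_slitPlane_iff]
  by_cases h : t * Real.cos θ ^ 2 = 0
  · left
    rcases mul_eq_zero.1 h with h | h
    · simp [h]
    · have : Real.cos θ = 0 := by simpa using h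
      simp [this]
  · right; exact h

lemma shA_polar (t θ : ℝ) : ∃ r : ℝ, 0 < r ∧ r * Real.cos (shA t θ) = Real.cos θ ∧
    r * Real.sin (shA t θ) = Real.sin θ + t * Real.cos θ := by
  have hm := shA_ne t θ
  unfold shA
  set z : ℂ := ⟨1 + t * (Real.sin θ * Real.cos θ), t * Real.cos θ ^ 2⟩ with hz
  have hz0 : z ≠ 0 := Complex.slitPlane_ne_zero hm
  have h1 : ‖z‖ * Real.cos z.arg = 1 + t * (Real.sin θ * Real.cos θ) := by
    rw [Complex.norm_mul_cos_arg]
  have h2 : ‖z‖ * Real.sin z.arg = t * Real.cos θ ^ 2 := by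
    rw [Complex.norm_mul_sin_arg]
  refine ⟨‖z‖, norm_pos_iff.2 hz0, ?_, ?_⟩
  · rw [Real.cos_add]
    linear_combination Real.cos θ * h1 - Real.sin θ * h2
  · rw [Real.sin_add]
    linear_combination Real.sin θ * h1 + Real.cos θ * h2 +
      t * Real.cos θ * Real.sin_sq_add_cos_sq θ

lemma shA_ge {t : ℝ} (ht : 0 ≤ t) (θ : ℝ) : θ ≤ shA t θ := by
  have : 0 ≤ Complex.arg ⟨1 + t * (Real.sin θ * Real.cos θ), t * Real.cos θ ^ 2⟩ :=
    Complex.arg_nonneg_iff.2 (by positivity)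
  unfold shA; linarith

lemma shA_lt (t θ : ℝ) : shA t θ < θ + Real.pi := by
  have h1 := (Complex.mem_slitPlane_iff_arg.1 (shA_ne t θ)).1
  have h2 := Complex.arg_le_pi ⟨1 + t * (Real.sin θ * Real.cos θ), t * Real.cos θ ^ 2⟩
  unfold shA
  have := lt_of_le_of_ne h2 h1
  linarith

lemma shA_cont : Continuous (fun p : ℝ × ℝ => shA p.1 p.2) := by
  unfold shA
  refine continuous_snd.add ?_
  rw [continuous_iff_continuousAt]
  intro p
  refine ContinuousAt.comp (g := Complex.arg)
    (f := fun p : ℝ × ℝ => (⟨1 + p.1 * (Real.sin p.2 * Real.cos p.2), p.1 * Real.cos p.2 ^ 2⟩ : ℂ))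
    (Complex.continuousAt_arg (shA_ne p.1 p.2)) ?_
  refine Continuous.continuousAt ?_
  exact Complex.equivRealProdCLM.symm.continuous.comp
    (f := fun p : ℝ × ℝ => (1 + p.1 * (Real.sin p.2 * Real.cos p.2), p.1 * Real.cos p.2 ^ 2))
    (by fun_prop)

lemma shA_strictMono {t : ℝ} (ht : 0 ≤ t) : StrictMono (shA t) := by
  intro a b hab
  by_cases hb : a + Real.pi ≤ b
  · linarith [shA_lt t a, shA_ge ht b]
  push Not at hb
  obtain ⟨r, hr, h1, h2⟩ := shA_polar t a
  obtain ⟨s, hs, h3, h4⟩ := shA_polar t b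
  by_contra! hle
  have hs1 : Real.sin (shA t a - shA t b) ≥ 0 :=
    Real.sin_nonneg_of_nonneg_of_le_pi (by linarith) (by linarith [shA_lt t a, shA_ge ht b])
  have hs2 : 0 < Real.sin (b - a) := Real.sin_pos_of_pos_of_lt_pi (by linarith) (by linarith)
  have : r * s * Real.sin (shA t a - shA t b) = - Real.sin (b - a) := by
    rw [Real.sin_sub, Real.sin_sub]
    linear_combination (s * Real.cos (shA t b)) * h2 - s * Real.sin (shA t b) * h1
      + (Real.sin a + t * Real.cos a) * h3 - Real.cos a * h4
  have : 0 ≤ r * s * Real.sin (shA t a - shA t b) := by positivity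
  linarith

lemma shA_mono {s t : ℝ} (hs : 0 ≤ s) (hst : s ≤ t) (θ : ℝ) : shA s θ ≤ shA t θ := by
  obtain ⟨r, hr, h1, h2⟩ := shA_polar s θ
  obtain ⟨q, hq, h3, h4⟩ := shA_polar t θ
  by_contra! hlt
  have hs1 : Real.sin (shA s θ - shA t θ) > 0 :=
    Real.sin_pos_of_pos_of_lt_pi (by linarith) (by linarith [shA_lt s θ, shA_ge (hs.trans hst) θ])
  have : r * q * Real.sin (shA s θ - shA t θ) = - ((t - s) * Real.cos θ ^ 2) := by
    rw [Real.sin_sub]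
    linear_combination (q * Real.cos (shA t θ)) * h2 - q * Real.sin (shA t θ) * h1
      + (Real.sin θ + s * Real.cos θ) * h3 - Real.cos θ * h4
  have : 0 < r * q * Real.sin (shA s θ - shA t θ) := by positivity
  have : 0 ≤ (t - s) * Real.cos θ ^ 2 := mul_nonneg (by linarith) (by positivity)
  linarith

noncomputable def liftF (c lam θ : ℝ) : ℝ := shA lam (shA (1 / c) (θ - Real.pi / 2) + Real.pi / 2)

lemma liftF_polar {c : ℝ} (lam θ : ℝ) : ∃ r : ℝ, 0 < r ∧
    r * Real.cos (liftF c lam θ) = Real.cos θ - Real.sin θ / c ∧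
    r * Real.sin (liftF c lam θ) = Real.sin θ + lam * (Real.cos θ - Real.sin θ / c) := by
  unfold liftF
  obtain ⟨r, hr, h1, h2⟩ := shA_polar (1 / c) (θ - Real.pi / 2)
  obtain ⟨q, hq, h3, h4⟩ := shA_polar lam (shA (1 / c) (θ - Real.pi / 2) + Real.pi / 2)
  rw [Real.cos_add_pi_div_two] at h3 h4
  rw [Real.sin_add_pi_div_two] at h4
  rw [Real.cos_sub_pi_div_two] at h1 h2
  rw [Real.sin_sub_pi_div_two] at h2
  refine ⟨r * q, by positivity, ?_, ?_⟩
  · linear_combination r * h3 - h2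
  · linear_combination r * h4 + h1 - lam * h2

lemma liftF_gt {c lam : ℝ} (hc : 0 < c) (hl : 0 < lam) (θ : ℝ) : θ < liftF c lam θ := by
  have a1 := shA_ge (one_div_pos.2 hc).le (θ - Real.pi / 2)
  have a2 := shA_ge hl.le (shA (1 / c) (θ - Real.pi / 2) + Real.pi / 2)
  by_contra! hle
  unfold liftF at hle
  have e1 : shA (1 / c) (θ - Real.pi / 2) = θ - Real.pi / 2 := by linarith
  have e2 : shA lam θ = θ := by
    rw [e1, sub_add_cancel] at hle a2
    linarith
  obtain ⟨r, hr, h1, h2⟩ := shA_polar (1 / c) (θ - Real.pi / 2)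
  obtain ⟨q, hq, h3, h4⟩ := shA_polar lam θ
  rw [e1] at h1 h2
  rw [e2] at h3 h4
  rw [Real.cos_sub_pi_div_two] at h1 h2
  rw [Real.sin_sub_pi_div_two] at h2
  have k1 : lam * Real.cos θ ^ 2 = 0 := by
    linear_combination Real.sin θ * h3 - Real.cos θ * h4
  have k2 : 1 / c * Real.sin θ ^ 2 = 0 := by
    linear_combination - Real.cos θ * h1 - Real.sin θ * h2
  have k3 : Real.cos θ ^ 2 = 0 := (mul_eq_zero.1 k1).resolve_left hl.ne'
  have k4 : Real.sin θ ^ 2 = 0 := (mul_eq_zero.1 k2).resolve_left (one_div_pos.2 hc).ne'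
  linarith [Real.sin_sq_add_cos_sq θ]

lemma liftF_lt (c lam θ : ℝ) : liftF c lam θ < θ + 2 * Real.pi := by
  have a1 := shA_lt (1 / c) (θ - Real.pi / 2)
  have a2 := shA_lt lam (shA (1 / c) (θ - Real.pi / 2) + Real.pi / 2)
  unfold liftF
  linarith

lemma Tan_eq_sin {a b : ℝ} (h : Tan a = Tan b) : Real.sin (a - b) = 0 := by
  unfold Tan at h
  rw [Real.sin_sub]
  split_ifs at h with h1 h2 h2
  · simp [h1, h2]
  · exact absurd h.symm (OnePoint.coe_ne_infty _)
  · exact absurd h (OnePoint.coe_ne_infty _)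
  · have h := OnePoint.coe_injective h
    rw [Real.tan_eq_sin_div_cos, Real.tan_eq_sin_div_cos, div_eq_div_iff h1 h2] at h
    linarith

lemma Tan_liftF {c lam : ℝ} (hc : 0 < c) (θ : ℝ) :
    Tan (liftF c lam θ) = Xi c lam (Tan θ) := by
  obtain ⟨r, hr, h1, h2⟩ := liftF_polar (c := c) lam θ
  by_cases hθ : Real.cos θ = 0
  · have hs : Real.sin θ ≠ 0 := fun h => by
      have := Real.sin_sq_add_cos_sq θ; simp [h, hθ] at this
    have hX : Xi c lam (Tan θ) = ((lam - c : ℝ) : OnePoint ℝ) := by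
      simp only [Tan, hθ, if_true]; rfl
    have hF : Real.cos (liftF c lam θ) ≠ 0 := fun h => by
      rw [h, hθ, mul_zero, zero_sub, zero_eq_neg] at h1
      exact (div_ne_zero hs hc.ne') h1
    rw [hX, Tan, if_neg hF, Real.tan_eq_sin_div_cos]
    congr 1
    rw [← mul_div_mul_left _ _ hr.ne', h1, h2, hθ]
    have hne : (0 : ℝ) - Real.sin θ / c ≠ 0 := by
      rw [zero_sub]; exact neg_ne_zero.2 (div_ne_zero hs hc.ne')
    have e : c * (Real.sin θ / c) = Real.sin θ := mul_div_cancel₀ _ hc.ne'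
    rw [div_eq_iff hne]
    linear_combination -e
  · have hX : Xi c lam (Tan θ) = if Real.tan θ = c then ∞ else
        ((Real.tan θ / (1 - Real.tan θ / c) + lam : ℝ) : OnePoint ℝ) := by
      simp only [Tan, hθ, if_false]; rfl
    have hsin : Real.sin θ = Real.tan θ * Real.cos θ := (Real.tan_mul_cos hθ).symm
    have h1' : r * Real.cos (liftF c lam θ) = Real.cos θ * (1 - Real.tan θ / c) := by
      rw [h1, hsin]; ring
    by_cases hb : Real.tan θ = c
    · have : Real.cos (liftF c lam θ) = 0 := by
        rw [hb, div_self hc.ne', sub_self, mul_zero] at h1'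
        exact (mul_eq_zero.1 h1').resolve_left hr.ne'
      rw [hX, if_pos hb, Tan, if_pos this]
    · have hb' : 1 - Real.tan θ / c ≠ 0 := fun h => hb (by field_simp at h; linarith)
      have hF : Real.cos (liftF c lam θ) ≠ 0 := fun h => by
        rw [h, mul_zero] at h1'
        exact mul_ne_zero hθ hb' h1'.symm
      rw [hX, if_neg hb, Tan, if_neg hF, Real.tan_eq_sin_div_cos]
      congr 1
      rw [← mul_div_mul_left _ _ hr.ne', h1', h2, div_eq_iff (mul_ne_zero hθ hb'), hsin]
      have : Real.tan θ / (1 - Real.tan θ / c) * (1 - Real.tan θ / c) = Real.tan θ :=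
        div_mul_cancel₀ _ hb'
      linear_combination - Real.cos θ * this

lemma mem_Iset {c lam : ℝ} (hc : 0 < c) (hl : 0 < lam) (b : ℝ) :
    b ∈ Iset lam c ↔ b ^ 2 - lam * b + lam * c ≤ 0 := by
  unfold Iset
  split_ifs with h
  · have hd : 0 ≤ lam ^ 2 - 4 * lam * c := by nlinarith
    have e : b ^ 2 - lam * b + lam * c ≤ 0 ↔ (2 * b - lam) ^ 2 ≤ lam ^ 2 - 4 * lam * c := by
      constructor <;> intro h <;> nlinarith
    rw [e, Real.sq_le hd, Set.mem_Icc]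
    constructor <;> rintro ⟨h1, h2⟩ <;> constructor <;> linarith
  · push Not at h
    simp only [Set.mem_empty_iff_false, false_iff, not_le]
    nlinarith [sq_nonneg (2 * b - lam), mul_pos hl (sub_pos.2 h)]

lemma liftF_sin {c lam : ℝ} (hc : 0 < c) (θ : ℝ) : ∃ r : ℝ, 0 < r ∧
    r * Real.sin (liftF c lam θ - θ) =
      Real.sin θ ^ 2 - lam * Real.sin θ * Real.cos θ + lam * c * Real.cos θ ^ 2 := by
  obtain ⟨r, hr, h1, h2⟩ := liftF_polar (c := c) lam θ
  refine ⟨c * r, by positivity, ?_⟩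
  have e : c * (Real.sin θ / c) = Real.sin θ := mul_div_cancel₀ _ hc.ne'
  rw [Real.sin_sub]
  linear_combination c * Real.cos θ * h2 - c * Real.sin θ * h1
    + (Real.sin θ - lam * Real.cos θ) * e

lemma ind_cases {c lam : ℝ} (hc : 0 < c) (hl : 0 < lam) (θ : ℝ) :
    (indI lam c (Tan θ) = 1 ∧ Real.sin (liftF c lam θ - θ) ≤ 0) ∨
    (indI lam c (Tan θ) = 0 ∧ 0 < Real.sin (liftF c lam θ - θ)) := by
  obtain ⟨r, hr, h⟩ := liftF_sin (lam := lam) hc θ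
  by_cases hθ : Real.cos θ = 0
  · right
    constructor
    · simp only [Tan, hθ, if_true]; rfl
    · have hs := Real.sin_sq_add_cos_sq θ
      rw [hθ] at h hs
      refine pos_of_mul_pos_right (a := r) ?_ hr.le
      rw [h]; nlinarith
  · have hX : indI lam c (Tan θ) = (Iset lam c).indicator (fun _ => (1 : ℝ)) (Real.tan θ) := by
      simp only [Tan, hθ, if_false]; rfl
    have h' : r * Real.sin (liftF c lam θ - θ) =
        Real.cos θ ^ 2 * (Real.tan θ ^ 2 - lam * Real.tan θ + lam * c) := by
      rw [h]
      rw [← Real.tan_mul_cos hθ]; ring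
    have hp : 0 < Real.cos θ ^ 2 := by positivity
    by_cases hm : Real.tan θ ∈ Iset lam c
    · left
      refine ⟨by rw [hX, Set.indicator_of_mem hm], ?_⟩
      rw [mem_Iset hc hl] at hm
      by_contra! hn
      have := mul_pos hr hn
      nlinarith
    · right
      refine ⟨by rw [hX, Set.indicator_of_notMem hm], ?_⟩
      rw [mem_Iset hc hl, not_le] at hm
      refine pos_of_mul_pos_right (a := r) ?_ hr.le
      rw [h']; positivity

lemma phi_eq {c lam : ℝ} (hc : 0 < c) (hl : 0 < lam) (θ : ℝ) :
    phi c lam θ = liftF c lam θ := by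
  have hgt := liftF_gt hc hl θ
  have hlt := liftF_lt c lam θ
  have key : θ + Real.pi * indI lam c (Tan θ) ≤ liftF c lam θ ∧
      liftF c lam θ < θ + Real.pi * indI lam c (Tan θ) + Real.pi := by
    rcases ind_cases hc hl θ with ⟨h1, h2⟩ | ⟨h1, h2⟩ <;> rw [h1]
    · refine ⟨?_, by linarith⟩
      by_contra! hn
      have := Real.sin_pos_of_pos_of_lt_pi (x := liftF c lam θ - θ) (by linarith) (by linarith)
      linarith
    · refine ⟨by linarith, ?_⟩
      by_contra! hn
      have := Real.sin_nonneg_of_nonneg_of_le_pi (x := liftF c lam θ - θ - Real.pi)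
        (by linarith) (by linarith)
      rw [Real.sin_sub_pi] at this
      linarith
  refine IsLeast.csInf_eq ⟨⟨key.1, Tan_liftF hc θ⟩, ?_⟩
  rintro θ' ⟨h1, h2⟩
  by_contra! hn
  have h3 := Tan_eq_sin ((Tan_liftF (lam := lam) hc θ).trans h2.symm)
  have := Real.sin_pos_of_pos_of_lt_pi (x := liftF c lam θ - θ') (by linarith) (by linarith [key.2])
  linarith

lemma theta_aux (N : ℕ) (c : ℕ → ℝ)
    (hc : ∀ x, 1 ≤ x → x ≤ N - 1 → 0 < c x) (k : ℕ) (hk : k + 2 ≤ N + 1) :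
    ContinuousOn (fun lam : ℝ => thetaSeq c lam (k + 2)) (Set.Ioi 0) ∧
    StrictMonoOn (fun lam : ℝ => thetaSeq c lam (k + 2)) (Set.Ioi 0) := by
  induction k with
  | zero =>
    exact ⟨Real.continuous_arctan.continuousOn, Real.arctan_strictMono.strictMonoOn _⟩
  | succ k ih =>
    obtain ⟨i1, i2⟩ := ih (by omega)
    have hck : 0 < c (k + 1) := hc _ (by omega) (by omega)
    have e : ∀ lam ∈ Set.Ioi (0 : ℝ), thetaSeq c lam (k + 1 + 2) =
        liftF (c (k + 1)) lam (thetaSeq c lam (k + 2)) := fun lam hl => phi_eq hck hl _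
    constructor
    · refine ContinuousOn.congr ?_ e
      have hg : Continuous (fun p : ℝ × ℝ => liftF (c (k + 1)) p.1 p.2) := by
        unfold liftF
        refine shA_cont.comp (f := fun p : ℝ × ℝ =>
          (p.1, shA (1 / c (k + 1)) (p.2 - Real.pi / 2) + Real.pi / 2)) ?_
        refine continuous_fst.prodMk (Continuous.add ?_ continuous_const)
        exact shA_cont.comp (f := fun p : ℝ × ℝ => (1 / c (k + 1), p.2 - Real.pi / 2))
          (by fun_prop)
      exact hg.comp_continuousOn (continuousOn_id.prodMk i1)
    · intro a ha b hb hab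
      have ha' : (0 : ℝ) < a := ha
      have hb' : (0 : ℝ) < b := hb
      show thetaSeq c a (k + 1 + 2) < thetaSeq c b (k + 1 + 2)
      rw [e a ha, e b hb]
      unfold liftF
      refine (shA_mono ha'.le hab.le _).trans_lt (shA_strictMono hb'.le ?_)
      have := shA_strictMono (one_div_pos.2 hck).le
        (sub_lt_sub_right (i2 ha hb hab) (Real.pi / 2))
      exact add_lt_add_left this _

theorem thetaSeq_continuous_strictMono (N : ℕ) (hN : 2 ≤ N) (c : ℕ → ℝ)
    (hc : ∀ x, 1 ≤ x → x ≤ N - 1 → 0 < c x)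
    (x : ℕ) (hx : 2 ≤ x) (hx' : x ≤ N + 1) :
    ContinuousOn (fun lam : ℝ => thetaSeq c lam x) (Set.Ioi 0) ∧
    StrictMonoOn (fun lam : ℝ => thetaSeq c lam x) (Set.Ioi 0) := by
  obtain ⟨k, rfl⟩ := Nat.exists_eq_add_of_le' hx
  exact theta_aux N c hc k hx'
end

section
/- Let N ≥ 2, let c : {1,…,N−1} → (0,∞) be conductances, let k ∈ {1,…,N−1} and let λ > 0 satisfy θ(λ,N+1) = k·π. For i ∈ {1,…,k−1} let x_i ∈ {2,…,N−1} satisfy θ(λ,x_i) ≤ i·π < θ(λ,x_i+1). Then for each i: (a) if θ(λ,x_i) < i·π, then (f^λ(x_i) − f^λ(x_i−1))·(f^λ(x_i+1) − f^λ(x_i)) < 0, i.e., f^λ admits a local extremum at ⟦x_i,x_i⟧; (b) if θ(λ,x_i) = i·π, then f^λ(x_i−1) = f^λ(x_i) and f^λ admits a local extremum at ⟦x_i−1,x_i⟧. -/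
open OnePoint

/-- The function `f^λ`: `f^λ(0) = f^λ(1) = 1` and
`f^λ(x+1) = f^λ(x) + c(x)⁻¹·[c(x−1)·(f^λ(x) − f^λ(x−1)) − λ·f^λ(x)]` for `x ≥ 1`
(for `x = 1` the term `c(0)·(f^λ(1) − f^λ(0))` vanishes automatically). -/
noncomputable def fseq (c : ℕ → ℝ) (lam : ℝ) : ℕ → ℝ
  | 0 => 1
  | 1 => 1
  | x + 2 => fseq c lam (x + 1) +
      (c (x + 1))⁻¹ * (c x * (fseq c lam (x + 1) - fseq c lam x) - lam * fseq c lam (x + 1))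

/-- `f` admits a local maximum at `⟦b, c⟧`. -/
def AdmitsLocalMax (N : ℕ) (f : ℕ → ℝ) (b c : ℕ) : Prop :=
  2 ≤ b ∧ b ≤ c ∧ c ≤ N - 1 ∧ (∀ x ∈ Finset.Icc b c, f x = f b) ∧
    f (b - 1) < f b ∧ f (c + 1) < f c

/-- `f` admits a local minimum at `⟦b, c⟧`. -/
def AdmitsLocalMin (N : ℕ) (f : ℕ → ℝ) (b c : ℕ) : Prop :=
  2 ≤ b ∧ b ≤ c ∧ c ≤ N - 1 ∧ (∀ x ∈ Finset.Icc b c, f x = f b) ∧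
    f b < f (b - 1) ∧ f c < f (c + 1)

/-- `f` admits a local extremum at `⟦b, c⟧`. -/
def AdmitsLocalExtremum (N : ℕ) (f : ℕ → ℝ) (b c : ℕ) : Prop :=
  AdmitsLocalMax N f b c ∨ AdmitsLocalMin N f b c

lemma aux_Tan_eq {x y : ℝ} (h : Tan x = Tan y) : Real.sin (x - y) = 0 := by
  unfold Tan at h
  rw [Real.sin_sub]
  by_cases hx : Real.cos x = 0 <;> by_cases hy : Real.cos y = 0
  · simp [hx, hy]
  · simp [hx, hy] at h
  · simp [hx, hy] at h
  · simp only [hx, hy, if_false] at h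
    have h' : Real.tan x = Real.tan y := by exact_mod_cast h
    rw [Real.tan_eq_sin_div_cos, Real.tan_eq_sin_div_cos, div_eq_div_iff hx hy] at h'
    linarith

lemma aux_polar (F J a : ℝ) (h : F ≠ 0 ∨ J ≠ 0) :
    ∃ t r : ℝ, a ≤ t ∧ t < a + Real.pi ∧ r ≠ 0 ∧ F = r * Real.cos t ∧ J = r * Real.sin t := by
  set z : ℂ := ⟨F, J⟩ with hz
  have hz0 : z ≠ 0 := by
    intro h0
    have h1 := congrArg Complex.re h0
    have h2 := congrArg Complex.im h0
    simp [hz] at h1 h2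
    tauto
  have hF : F = ‖z‖ * Real.cos z.arg := by rw [Complex.norm_mul_cos_arg]
  have hJ : J = ‖z‖ * Real.sin z.arg := by rw [Complex.norm_mul_sin_arg]
  have hn : ‖z‖ ≠ 0 := norm_ne_zero_iff.mpr hz0
  have hm := toIcoMod_mem_Ico Real.pi_pos a z.arg
  have he : toIcoMod Real.pi_pos a z.arg = z.arg - toIcoDiv Real.pi_pos a z.arg * Real.pi := by
    rw [toIcoMod]; simp
  set m := toIcoDiv Real.pi_pos a z.arg
  refine ⟨toIcoMod Real.pi_pos a z.arg, ‖z‖ * (-1) ^ m, hm.1, hm.2, ?_, ?_, ?_⟩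
  · exact mul_ne_zero hn (zpow_ne_zero _ (by norm_num))
  · rw [he, Real.cos_sub_int_mul_pi]
    have : ((-1 : ℝ) ^ m) * (-1) ^ m = 1 := by
      rw [← mul_zpow]; simp
    calc F = ‖z‖ * Real.cos z.arg := hF
      _ = ‖z‖ * (((-1 : ℝ) ^ m) * (-1) ^ m) * Real.cos z.arg := by rw [this]; ring
      _ = _ := by ring
  · rw [he, Real.sin_sub_int_mul_pi]
    have : ((-1 : ℝ) ^ m) * (-1) ^ m = 1 := by
      rw [← mul_zpow]; simp
    calc J = ‖z‖ * Real.sin z.arg := hJ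
      _ = ‖z‖ * (((-1 : ℝ) ^ m) * (-1) ^ m) * Real.sin z.arg := by rw [this]; ring
      _ = _ := by ring

lemma aux_Xi (c lam θ t r : ℝ) (hc : 0 < c) (hr : r ≠ 0)
    (hF : Real.cos θ - Real.sin θ / c = r * Real.cos t)
    (hJ : Real.sin θ + lam * (Real.cos θ - Real.sin θ / c) = r * Real.sin t) :
    Xi c lam (Tan θ) = Tan t := by
  have hsc := Real.sin_sq_add_cos_sq θ
  by_cases h0 : Real.cos θ = 0
  · have hs : Real.sin θ ≠ 0 := by
      intro h; rw [h, h0] at hsc; norm_num at hsc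
    have ht : Real.cos t ≠ 0 := by
      intro h; rw [h, h0] at hF
      apply hs
      field_simp at hF
      linarith
    have : Xi c lam (Tan θ) = ((lam - c : ℝ) : OnePoint ℝ) := by
      simp only [Tan, h0, if_true]; rfl
    rw [this]
    simp only [Tan, ht, if_false]
    congr 1
    rw [Real.tan_eq_sin_div_cos, eq_div_iff ht]
    apply mul_left_cancel₀ hr
    have : r * ((lam - c) * Real.cos t) = (lam - c) * (r * Real.cos t) := by ring
    rw [this, ← hF, ← hJ, h0]
    field_simp
    ring
  · have hb : Real.tan θ * Real.cos θ = Real.sin θ := Real.tan_mul_cos h0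
    have : Xi c lam (Tan θ) = if Real.tan θ = c then ∞ else
        ((Real.tan θ / (1 - Real.tan θ / c) + lam : ℝ) : OnePoint ℝ) := by
      simp only [Tan, h0, if_false]; rfl
    rw [this]
    set b := Real.tan θ
    rw [← hb] at hF hJ
    have hF' : r * Real.cos t = Real.cos θ * (1 - b / c) := by rw [← hF]; ring
    by_cases hbc : b = c
    · have : Real.cos t = 0 := by
        have : r * Real.cos t = 0 := by rw [hF', hbc, div_self hc.ne']; ring
        exact (mul_eq_zero.mp this).resolve_left hr
      simp [Tan, hbc, this]
    · have h1 : 1 - b / c ≠ 0 := by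
        intro h; apply hbc; field_simp at h; linarith
      have ht : Real.cos t ≠ 0 := by
        intro h
        rw [h, mul_zero] at hF'
        exact mul_ne_zero h0 h1 hF'.symm
      simp only [Tan, hbc, ht, if_false]
      congr 1
      rw [Real.tan_eq_sin_div_cos, eq_div_iff ht]
      apply mul_left_cancel₀ hr
      have : r * ((b / (1 - b / c) + lam) * Real.cos t)
        = (b / (1 - b / c) + lam) * (r * Real.cos t) := by ring
      rw [this, hF', ← hJ]
      have : (b / (1 - b / c) + lam) * (Real.cos θ * (1 - b / c)) =
        Real.cos θ * (b / (1 - b / c) * (1 - b / c)) + lam * (Real.cos θ * (1 - b / c)) := by ring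
      rw [this, div_mul_cancel₀ _ h1]
      ring

lemma aux_I (lam c b : ℝ) (hc : 0 < c) (hl : 0 < lam) :
    b ∈ Iset lam c ↔ b ^ 2 - lam * b + lam * c ≤ 0 := by
  unfold Iset
  split_ifs with h
  · have hd : 0 ≤ lam ^ 2 - 4 * lam * c := by nlinarith
    have hs := Real.sq_sqrt hd
    have hs0 := Real.sqrt_nonneg (lam ^ 2 - 4 * lam * c)
    set s := Real.sqrt (lam ^ 2 - 4 * lam * c)
    rw [Set.mem_Icc]
    constructor
    · rintro ⟨h1, h2⟩
      nlinarith [mul_nonneg (sub_nonneg.2 h1) (sub_nonneg.2 h2)]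
    · intro hq
      have : |2 * b - lam| ≤ s := by
        apply abs_le_of_sq_le_sq _ hs0 
        nlinarith
      obtain ⟨h1, h2⟩ := abs_le.1 this
      constructor <;> linarith
  · simp only [Set.mem_empty_iff_false, false_iff, not_le]
    push Not at h
    nlinarith [sq_nonneg (2 * b - lam), mul_pos hl (sub_pos.2 h)]

set_option maxHeartbeats 2000000 in
lemma aux_step (c lam θ : ℝ) (hc : 0 < c) (hl : 0 < lam) :
    ∃ r : ℝ, 0 < r ∧ Real.cos θ - Real.sin θ / c = r * Real.cos (phi c lam θ) ∧
      Real.sin θ + lam * (Real.cos θ - Real.sin θ / c) = r * Real.sin (phi c lam θ) ∧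
      ∀ i : ℕ, θ < i * Real.pi → i * Real.pi < phi c lam θ →
        Real.sin θ * Real.sin (phi c lam θ) < 0 := by
  have hsc := Real.sin_sq_add_cos_sq θ
  have hne : Real.cos θ - Real.sin θ / c ≠ 0 ∨
      Real.sin θ + lam * (Real.cos θ - Real.sin θ / c) ≠ 0 := by
    by_contra! h
    obtain ⟨h1, h2⟩ := h
    rw [h1, mul_zero, add_zero] at h2
    rw [h2] at h1 hsc
    simp at h1
    rw [h1] at hsc
    norm_num at hsc
  obtain ⟨t, r, hat, hta, hr, hF, hJ⟩ :=
    aux_polar _ _ (θ + Real.pi * indI lam c (Tan θ)) hne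
  have hXi := aux_Xi c lam θ t r hc hr hF hJ
  have hphi : phi c lam θ = t := by
    unfold phi
    rw [hXi]
    apply IsLeast.csInf_eq
    refine ⟨⟨hat, rfl⟩, ?_⟩
    rintro u ⟨hu1, hu2⟩
    by_contra! hlt
    have h1 := aux_Tan_eq hu2.symm
    have h2 := Real.sin_pos_of_pos_of_lt_pi (sub_pos.2 hlt) (by linarith)
    linarith
  rw [hphi]
  have hQ : r * Real.sin (t - θ) =
      (Real.sin θ ^ 2 - lam * Real.sin θ * Real.cos θ + lam * c * Real.cos θ ^ 2) / c := by
    rw [Real.sin_sub]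
    have : r * (Real.sin t * Real.cos θ - Real.cos t * Real.sin θ) =
      (r * Real.sin t) * Real.cos θ - (r * Real.cos t) * Real.sin θ := by ring
    rw [this, ← hF, ← hJ]
    field_simp
    ring
  have hind : (indI lam c (Tan θ) = 0 ∧
        0 < Real.sin θ ^ 2 - lam * Real.sin θ * Real.cos θ + lam * c * Real.cos θ ^ 2) ∨
      (indI lam c (Tan θ) = 1 ∧ Real.cos θ ≠ 0 ∧
        Real.sin θ ^ 2 - lam * Real.sin θ * Real.cos θ + lam * c * Real.cos θ ^ 2 ≤ 0) := by
    by_cases h0 : Real.cos θ = 0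
    · left
      constructor
      · simp only [Tan, h0, if_true]; rfl
      · rw [h0] at hsc ⊢; nlinarith
    · have hb : Real.tan θ * Real.cos θ = Real.sin θ := Real.tan_mul_cos h0
      have e : Real.sin θ ^ 2 - lam * Real.sin θ * Real.cos θ + lam * c * Real.cos θ ^ 2 =
          Real.cos θ ^ 2 * (Real.tan θ ^ 2 - lam * Real.tan θ + lam * c) := by
        rw [← hb]; ring
      have hp : 0 < Real.cos θ ^ 2 := by positivity
      have hi : indI lam c (Tan θ) =
          (Iset lam c).indicator (fun _ => (1 : ℝ)) (Real.tan θ) := by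
        simp only [Tan, h0, if_false]; rfl
      have hI := aux_I lam c (Real.tan θ) hc hl
      rw [e, hi]
      by_cases hm : Real.tan θ ∈ Iset lam c
      · right
        refine ⟨by simp [hm], h0, ?_⟩
        nlinarith [hI.1 hm]
      · left
        refine ⟨by simp [hm], ?_⟩
        have := lt_of_not_ge (fun h => hm (hI.2 h))
        positivity
  have hpi := Real.pi_pos
  have trig : ∀ i : ℕ, (Real.sin θ * Real.sin t =
        - (Real.sin (i * Real.pi - θ) * Real.sin (t - i * Real.pi))) ∧
      (Real.cos θ * Real.cos t = Real.cos (i * Real.pi - θ) * Real.cos (t - i * Real.pi)) ∧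
      (Real.sin θ * Real.cos θ = - (Real.sin (i * Real.pi - θ) * Real.cos (i * Real.pi - θ))) := by
    intro i
    have h1 : ((-1 : ℝ) ^ i) * (-1) ^ i = 1 := by rw [← mul_pow]; simp
    rw [Real.sin_sub_nat_mul_pi, Real.cos_sub_nat_mul_pi, Real.cos_nat_mul_pi_sub,
      Real.sin_nat_mul_pi_sub]
    refine ⟨?_, ?_, ?_⟩
    · linear_combination (-(Real.sin θ * Real.sin t)) * h1
    · linear_combination (-(Real.cos θ * Real.cos t)) * h1
    · linear_combination (-(Real.sin θ * Real.cos θ)) * h1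
  rcases hind with ⟨hi, hq⟩ | ⟨hi, h0, hq⟩
  · rw [hi] at hat hta
    have hpos : 0 < r * Real.sin (t - θ) := by rw [hQ]; positivity
    have hs : 0 ≤ Real.sin (t - θ) :=
      Real.sin_nonneg_of_nonneg_of_le_pi (by linarith) (by linarith)
    refine ⟨r, ?_, hF, hJ, ?_⟩
    · by_contra! h
      nlinarith
    · intro i h1 h2
      rw [(trig i).1]
      have a1 := Real.sin_pos_of_pos_of_lt_pi (sub_pos.2 h1) (by linarith)
      have a2 := Real.sin_pos_of_pos_of_lt_pi (sub_pos.2 h2) (by linarith)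
      nlinarith
  · rw [hi] at hat hta
    have hp : 0 < Real.cos θ ^ 2 := by positivity
    have hb : Real.tan θ * Real.cos θ = Real.sin θ := Real.tan_mul_cos h0
    have hb2 : Real.tan θ ^ 2 - lam * Real.tan θ + lam * c ≤ 0 := by
      rw [← hb] at hq
      by_contra! h
      nlinarith
    set b := Real.tan θ
    have hbc : c < b := by
      by_contra! h
      have h3 : b ^ 2 ≤ 0 := by nlinarith [mul_nonneg hl.le (sub_nonneg.2 h)]
      have h4 : b = 0 := by nlinarith
      rw [h4] at hb2
      nlinarith [mul_pos hl hc]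
    have hFb : r * Real.cos t = Real.cos θ * (1 - b / c) := by rw [← hF, ← hb]; ring
    have hbc1 : 1 - b / c < 0 := by
      have := (one_lt_div hc).2 hbc
      linarith
    have hrp : 0 < r := by
      have hle : r * Real.sin (t - θ) ≤ 0 := by
        rw [hQ]; exact div_nonpos_of_nonpos_of_nonneg hq hc.le
      have hsin : Real.sin (t - θ) = - Real.sin (t - θ - Real.pi) := by
        rw [Real.sin_sub_pi]; ring
      rcases (show θ + Real.pi ≤ t by linarith).eq_or_lt with he | hlt
      · rw [← he, Real.cos_add_pi] at hFb
        have : Real.cos θ * (1 - b / c + r) = 0 := by linarith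
        have := (mul_eq_zero.mp this).resolve_left h0
        linarith
      · have := Real.sin_pos_of_pos_of_lt_pi (x := t - θ - Real.pi) (by linarith) (by linarith)
        rw [hsin] at hle
        by_contra! h
        have h5 : r < 0 := lt_of_le_of_ne h hr
        nlinarith
    refine ⟨r, hrp, hF, hJ, ?_⟩
    intro i h1 h2
    obtain ⟨t1, t2, t3⟩ := trig i
    have hcc : Real.cos θ * Real.cos t < 0 := by
      have : r * (Real.cos θ * Real.cos t) < 0 := by
        have : r * (Real.cos θ * Real.cos t) = Real.cos θ ^ 2 * (1 - b / c) := by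
          linear_combination Real.cos θ * hFb
        rw [this]
        nlinarith
      by_contra! h
      nlinarith
    have hscp : 0 < Real.sin θ * Real.cos θ := by
      rw [← hb]
      have := hc.trans hbc
      nlinarith
    rw [t1]
    rw [t2] at hcc
    rw [t3] at hscp
    have hα : 0 < i * Real.pi - θ := sub_pos.2 h1
    have hβ : 0 < t - i * Real.pi := sub_pos.2 h2
    have hs1 : (i * Real.pi - θ) + (t - i * Real.pi) < 2 * Real.pi := by linarith
    generalize i * Real.pi - θ = α at *
    generalize t - i * Real.pi = β at *
    have key : 0 < Real.sin α * Real.sin β := by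
      rcases lt_or_ge α Real.pi with hα1 | hα1
      · have sa := Real.sin_pos_of_pos_of_lt_pi hα hα1
        have ca : Real.cos α < 0 := by by_contra! h; nlinarith
        have cb : 0 < Real.cos β := by by_contra! h; nlinarith
        have hα2 : Real.pi / 2 < α := by
          by_contra! h
          have := Real.cos_nonneg_of_neg_pi_div_two_le_of_le (x := α) (by linarith) h
          linarith
        have hβ2 : β < Real.pi / 2 := by
          by_contra! h
          have := Real.cos_nonpos_of_pi_div_two_le_of_le h (by linarith)
          linarith
        have sb := Real.sin_pos_of_pos_of_lt_pi hβ (by linarith)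
        positivity
      · exfalso
        have sa : Real.sin α ≤ 0 := by
          have := Real.sin_nonneg_of_nonneg_of_le_pi (x := α - Real.pi) (by linarith) (by linarith)
          rw [Real.sin_sub_pi] at this
          linarith
        have ca : 0 < Real.cos α := by by_contra! h; nlinarith
        have cb : Real.cos β < 0 := by by_contra! h; nlinarith
        have hα2 : Real.pi + Real.pi / 2 < α := by
          by_contra! h
          have := Real.cos_nonpos_of_pi_div_two_le_of_le (x := α) (by linarith) (by linarith)
          linarith
        have := Real.cos_nonneg_of_neg_pi_div_two_le_of_le (x := β) (by linarith) (by linarith)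
        linarith
    linarith

lemma aux_inv (N : ℕ) (c : ℕ → ℝ) (hc : ∀ y, 1 ≤ y → y ≤ N - 1 → 0 < c y)
    (lam : ℝ) (hlam : 0 < lam) (x : ℕ) (hx : x + 1 ≤ N - 1) :
    ∃ s : ℝ, 0 < s ∧ fseq c lam (x + 1) = s * Real.cos (thetaSeq c lam (x + 2)) ∧
      -(c (x + 1) * (fseq c lam (x + 2) - fseq c lam (x + 1)))
        = s * Real.sin (thetaSeq c lam (x + 2)) := by
  induction x with
  | zero =>
    have h1 := (hc 1 le_rfl hx).ne'
    have hcp := Real.cos_arctan_pos lam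
    refine ⟨(Real.cos (Real.arctan lam))⁻¹, by positivity, ?_, ?_⟩
    · simp only [fseq, thetaSeq]
      field_simp
    · simp only [fseq, thetaSeq]
      have := Real.tan_arctan lam
      rw [Real.tan_eq_sin_div_cos] at this
      rw [mul_comm (Real.cos (Real.arctan lam))⁻¹, ← div_eq_mul_inv, this]
      simp only [zero_add]
      field_simp
      ring
  | succ x ih =>
    obtain ⟨s, hs, hf, hJ⟩ := ih (by omega)
    have hc1 := hc (x + 1) (by omega) (by omega)
    have hc2 := hc (x + 2) (by omega) (by omega)
    obtain ⟨r, hr, h1, h2, -⟩ := aux_step (c (x + 1)) lam (thetaSeq c lam (x + 2)) hc1 hlam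
    have ht : thetaSeq c lam (x + 1 + 2) = phi (c (x + 1)) lam (thetaSeq c lam (x + 2)) := rfl
    have hf3 : fseq c lam (x + 1 + 2) = fseq c lam (x + 2) + (c (x + 2))⁻¹ *
      (c (x + 1) * (fseq c lam (x + 2) - fseq c lam (x + 1)) - lam * fseq c lam (x + 2)) := rfl
    have hf2 : fseq c lam (x + 2) = s * (r * Real.cos (thetaSeq c lam (x + 1 + 2))) := by
      rw [ht, ← h1, mul_sub, ← hf, ← mul_div_assoc, ← hJ]
      field_simp
      ring
    refine ⟨s * r, by positivity, ?_, ?_⟩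
    · rw [mul_assoc]; exact hf2
    · rw [hf3, mul_assoc, ht, ← h2, mul_add, ← hJ, h1, mul_left_comm, ← ht, ← hf2]
      change -(c (x + 2) * _) = _
      field_simp
      ring

/-- The crossing points `x_i` are local extrema of `f^λ`. -/
theorem crossing_points_are_extrema (N : ℕ) (hN : 2 ≤ N) (c : ℕ → ℝ)
    (hc : ∀ y, 1 ≤ y → y ≤ N - 1 → 0 < c y)
    (k : ℕ) (hk : 1 ≤ k) (hk' : k ≤ N - 1)
    (lam : ℝ) (hlam : 0 < lam)
    (hθN : thetaSeq c lam (N + 1) = (k : ℝ) * Real.pi)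
    (i : ℕ) (hi : 1 ≤ i) (hi' : i ≤ k - 1)
    (xi : ℕ) (hxi : 2 ≤ xi) (hxi' : xi ≤ N - 1)
    (h1 : thetaSeq c lam xi ≤ (i : ℝ) * Real.pi)
    (h2 : (i : ℝ) * Real.pi < thetaSeq c lam (xi + 1)) :
    (thetaSeq c lam xi < (i : ℝ) * Real.pi →
      (fseq c lam xi - fseq c lam (xi - 1)) * (fseq c lam (xi + 1) - fseq c lam xi) < 0 ∧
      AdmitsLocalExtremum N (fseq c lam) xi xi) ∧
    (thetaSeq c lam xi = (i : ℝ) * Real.pi →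
      fseq c lam (xi - 1) = fseq c lam xi ∧
      AdmitsLocalExtremum N (fseq c lam) (xi - 1) xi) := by
  obtain ⟨x, rfl⟩ : ∃ x, xi = x + 2 := ⟨xi - 2, by omega⟩
  have hc1 := hc (x + 1) (by omega) (by omega)
  have hc2 := hc (x + 2) (by omega) (by omega)
  obtain ⟨s, hs, hf, hJ⟩ := aux_inv N c hc lam hlam x (by omega)
  obtain ⟨s', hs', hf', hJ'⟩ := aux_inv N c hc lam hlam (x + 1) (by omega)
  obtain ⟨r, hr, -, -, hcross⟩ := aux_step (c (x + 1)) lam (thetaSeq c lam (x + 2)) hc1 hlam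
  change -(c (x + 2) * (fseq c lam (x + 3) - fseq c lam (x + 2)))
    = s' * Real.sin (thetaSeq c lam (x + 3)) at hJ'
  have e1 : x + 2 - 1 = x + 1 := rfl
  have hf3 : fseq c lam (x + 3) = fseq c lam (x + 2) + (c (x + 2))⁻¹ *
    (c (x + 1) * (fseq c lam (x + 2) - fseq c lam (x + 1)) - lam * fseq c lam (x + 2)) := rfl
  rw [e1]
  constructor
  · intro hlt
    have hsin : Real.sin (thetaSeq c lam (x + 2)) * Real.sin (thetaSeq c lam (x + 3)) < 0 :=
      hcross i hlt h2
    have hprod : (fseq c lam (x + 2) - fseq c lam (x + 1)) *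
        (fseq c lam (x + 3) - fseq c lam (x + 2)) < 0 := by
      have e : (c (x + 1) * c (x + 2)) * ((fseq c lam (x + 2) - fseq c lam (x + 1)) *
        (fseq c lam (x + 3) - fseq c lam (x + 2))) = (s * s') *
          (Real.sin (thetaSeq c lam (x + 2)) * Real.sin (thetaSeq c lam (x + 3))) := by
        linear_combination (-(c (x + 2) * (fseq c lam (x + 3) - fseq c lam (x + 2)))) * hJ +
          (s * Real.sin (thetaSeq c lam (x + 2))) * hJ'
      have h3 := mul_neg_of_pos_of_neg (mul_pos hs hs') hsin
      rw [← e] at h3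
      exact neg_of_mul_neg_right h3 (mul_pos hc1 hc2).le
    refine ⟨hprod, ?_⟩
    have hconst : ∀ y ∈ Finset.Icc (x + 2) (x + 2), fseq c lam y = fseq c lam (x + 2) := by
      intro y hy
      rw [Finset.Icc_self, Finset.mem_singleton] at hy
      rw [hy]
    rcases mul_neg_iff.1 hprod with ⟨ha, hb⟩ | ⟨ha, hb⟩
    · left
      exact ⟨hxi, le_rfl, hxi', hconst, sub_pos.1 ha, sub_neg.1 hb⟩
    · right
      exact ⟨hxi, le_rfl, hxi', hconst, sub_neg.1 ha, sub_pos.1 hb⟩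
  · intro heq
    have hsin : Real.sin (thetaSeq c lam (x + 2)) = 0 := by rw [heq]; exact Real.sin_nat_mul_pi i
    have hcos : Real.cos (thetaSeq c lam (x + 2)) ≠ 0 := by
      intro h
      have := Real.sin_sq_add_cos_sq (thetaSeq c lam (x + 2))
      rw [hsin, h] at this
      norm_num at this
    have hfne : fseq c lam (x + 1) ≠ 0 := by rw [hf]; exact mul_ne_zero hs.ne' hcos
    have hfe : fseq c lam (x + 2) = fseq c lam (x + 1) := by
      rw [hsin, mul_zero, neg_eq_zero] at hJ
      have := (mul_eq_zero.mp hJ).resolve_left hc1.ne'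
      linarith
    refine ⟨hfe.symm, ?_⟩
    obtain ⟨z, rfl⟩ : ∃ z, x = z + 1 := by
      rcases x with _ | z
      · exfalso
        have ha : thetaSeq c lam (0 + 2) = Real.arctan lam := rfl
        rw [ha] at heq
        have h4 := Real.arctan_lt_pi_div_two lam
        have h5 : (1 : ℝ) ≤ i := by exact_mod_cast hi
        nlinarith [Real.pi_pos]
      · exact ⟨z, rfl⟩
    have hc0 := hc (z + 1) (by omega) (by omega)
    have hf2 : fseq c lam (z + 1 + 2) = fseq c lam (z + 2) + (c (z + 2))⁻¹ *
      (c (z + 1) * (fseq c lam (z + 2) - fseq c lam (z + 1)) - lam * fseq c lam (z + 2)) := rfl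
    change 0 < c (z + 2) at hc1
    change fseq c lam (z + 1 + 2) = fseq c lam (z + 2) at hfe
    change fseq c lam (z + 2) ≠ 0 at hfne
    have hA : c (z + 1) * (fseq c lam (z + 2) - fseq c lam (z + 1)) =
        lam * fseq c lam (z + 2) := by
      rw [hf2] at hfe
      have h6 : (c (z + 2))⁻¹ * (c (z + 1) * (fseq c lam (z + 2) - fseq c lam (z + 1)) -
        lam * fseq c lam (z + 2)) = 0 := by linarith
      have := (mul_eq_zero.mp h6).resolve_left (inv_ne_zero hc1.ne')
      linarith
    have hB : c (z + 1 + 2) * (fseq c lam (z + 1 + 3) - fseq c lam (z + 1 + 2)) =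
        -(lam * fseq c lam (z + 2)) := by
      rw [hf3]
      change c (z + 1 + 2) * (_ + _ * (c (z + 2) * (_ - fseq c lam (z + 2)) - _) - _) = _
      rw [hfe]
      field_simp
      ring
    have hconst : ∀ y ∈ Finset.Icc (z + 1 + 1) (z + 1 + 2),
        fseq c lam y = fseq c lam (z + 1 + 1) := by
      intro y hy
      rw [Finset.mem_Icc] at hy
      obtain rfl | rfl : y = z + 1 + 1 ∨ y = z + 1 + 2 := by omega
      · rfl
      · exact hfe
    rcases lt_or_gt_of_ne hfne with hneg | hpos
    · right
      have hl := mul_neg_of_pos_of_neg hlam hneg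
      refine ⟨by omega, by omega, hxi', hconst, ?_, ?_⟩
      · change fseq c lam (z + 2) < fseq c lam (z + 1)
        by_contra! h
        nlinarith [mul_nonneg hc0.le (sub_nonneg.2 h)]
      · change fseq c lam (z + 1 + 2) < fseq c lam (z + 1 + 3)
        by_contra! h
        nlinarith [mul_nonneg hc2.le (sub_nonneg.2 h)]
    · left
      have hl := mul_pos hlam hpos
      refine ⟨by omega, by omega, hxi', hconst, ?_, ?_⟩
      · change fseq c lam (z + 1) < fseq c lam (z + 2)
        by_contra! h
        nlinarith [mul_nonneg hc0.le (sub_nonneg.2 h)]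
      · change fseq c lam (z + 1 + 3) < fseq c lam (z + 1 + 2)
        by_contra! h
        nlinarith [mul_nonneg hc2.le (sub_nonneg.2 h)]
end

section
/- Let N ≥ 2, let c : {1,…,N−1} → (0,∞) be conductances, let k ∈ {1,…,N−1} and let λ > 0 satisfy θ(λ,N+1) = k·π. For i ∈ {1,…,k−1} let x_i ∈ {2,…,N−1} satisfy θ(λ,x_i) ≤ i·π < θ(λ,x_i+1). If x ∈ {2,…,N−1} does not belong to the set {x_i : 1 ≤ i ≤ k−1} ∪ {x_i − 1 : 1 ≤ i ≤ k−1 with θ(λ,x_i) = i·π}, then there is no interval ⟦b,c⟧ with 2 ≤ b ≤ x ≤ c ≤ N−1 at which f^λ admits a local extremum. -/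
open OnePoint

noncomputable def TT (f E : ℝ) : OnePoint ℝ := if f = 0 then ∞ else ((E / f : ℝ) : OnePoint ℝ)

lemma Tan_eq_TT (θ : ℝ) : Tan θ = TT (Real.cos θ) (Real.sin θ) := by
  unfold Tan TT
  rw [Real.tan_eq_sin_div_cos]

lemma TT_cross {f E f' E' : ℝ} (h : TT f E = TT f' E') : f * E' = f' * E := by
  unfold TT at h
  by_cases h1 : f = 0 <;> by_cases h2 : f' = 0
  · simp [h1, h2]
  · simp [h1, h2] at h
  · simp [h1, h2] at h
  · simp only [h1, h2, if_false] at h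
    have h3 : E / f = E' / f' := OnePoint.coe_injective h
    field_simp at h3
    linarith

lemma Tan_add_int (θ : ℝ) (n : ℤ) : Tan (θ + n * Real.pi) = Tan θ := by
  unfold Tan
  rw [Real.tan_add_int_mul_pi]
  have h : (Real.cos (θ + n * Real.pi) = 0) ↔ (Real.cos θ = 0) := by
    rw [Real.cos_add_int_mul_pi]
    have : ((-1 : ℝ) ^ n) ≠ 0 := zpow_ne_zero _ (by norm_num)
    simp [this]
  simp only [h]

lemma Tan_inj {θ θ' : ℝ} (h : Tan θ = Tan θ') : ∃ n : ℤ, θ' = θ + n * Real.pi := by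
  rw [Tan_eq_TT, Tan_eq_TT] at h
  have h1 := TT_cross h
  have h2 : Real.sin (θ' - θ) = 0 := by rw [Real.sin_sub]; linarith
  obtain ⟨n, hn⟩ := Real.sin_eq_zero_iff.1 h2
  exact ⟨n, by linarith⟩

lemma Tan_surj (t : OnePoint ℝ) : ∃ θ, Tan θ = t := by
  induction t using OnePoint.rec with
  | infty => exact ⟨Real.pi / 2, by simp [Tan]⟩
  | coe r =>
    refine ⟨Real.arctan r, ?_⟩
    unfold Tan
    rw [if_neg (Real.cos_arctan_pos r).ne', Real.tan_arctan]

lemma phi_spec (c lam θ : ℝ) : θ + Real.pi * indI lam c (Tan θ) ≤ phi c lam θ ∧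
    Tan (phi c lam θ) = Xi c lam (Tan θ) := by
  obtain ⟨θ0, h0⟩ := Tan_surj (Xi c lam (Tan θ))
  set a := θ + Real.pi * indI lam c (Tan θ) with ha
  set m := toIcoMod Real.pi_pos a θ0 with hm
  have hmem := toIcoMod_mem_Ico Real.pi_pos a θ0
  have hmT : Tan m = Xi c lam (Tan θ) := by
    have := Tan_add_int m (toIcoDiv Real.pi_pos a θ0)
    rw [← this, ← h0]
    congr 1
    have := toIcoMod_add_toIcoDiv_zsmul Real.pi_pos a θ0
    rw [zsmul_eq_mul] at this
    exact this
  have hl : IsLeast {θ' : ℝ | a ≤ θ' ∧ Tan θ' = Xi c lam (Tan θ)} m := by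
    refine ⟨⟨hmem.1, hmT⟩, ?_⟩
    rintro θ' ⟨h1, h2⟩
    obtain ⟨z, hz⟩ := Tan_inj (hmT.trans h2.symm)
    by_contra hlt
    push Not at hlt
    have hz0 : z < 0 := by
      by_contra hz1
      push Not at hz1
      have : (0 : ℝ) ≤ z := by exact_mod_cast hz1
      nlinarith [Real.pi_pos]
    have : (z : ℝ) ≤ -1 := by exact_mod_cast (by omega : z ≤ -1)
    have h3 := hmem.2
    rw [← hm] at h3
    nlinarith [Real.pi_pos]
  have he : phi c lam θ = m := hl.csInf_eq
  rw [he]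
  exact hl.1

lemma indI_nonneg (lam c : ℝ) (b : OnePoint ℝ) : 0 ≤ indI lam c b := by
  induction b using OnePoint.rec with
  | infty => exact le_refl (0 : ℝ)
  | coe r => exact Set.indicator_nonneg (fun _ _ => zero_le_one) r

lemma le_phi (c lam θ : ℝ) : θ ≤ phi c lam θ := by
  have h := (phi_spec c lam θ).1
  nlinarith [Real.pi_pos, indI_nonneg lam c (Tan θ), mul_nonneg Real.pi_pos.le (indI_nonneg lam c (Tan θ))]

lemma Xi_TT (c lam f E : ℝ) (hc : 0 < c) (h : f ≠ 0 ∨ E ≠ 0) :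
    Xi c lam (TT f E) = TT (f - E / c) (E + lam * (f - E / c)) := by
  unfold TT
  by_cases hf : f = 0
  · subst hf
    have hE : E ≠ 0 := by simpa using h
    have h1 : (0 : ℝ) - E / c ≠ 0 := by
      rw [zero_sub]; exact neg_ne_zero.2 (div_ne_zero hE hc.ne')
    rw [if_pos rfl, if_neg h1]
    change ((lam - c : ℝ) : OnePoint ℝ) = _
    congr 1
    rw [eq_div_iff h1]
    field_simp
    ring
  · rw [if_neg hf]
    change (if E / f = c then (∞ : OnePoint ℝ) else
      (((E / f) / (1 - (E / f) / c) + lam : ℝ) : OnePoint ℝ)) = _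
    have hiff : E / f = c ↔ f - E / c = 0 := by
      rw [div_eq_iff hf, sub_eq_zero, eq_div_iff hc.ne']
      constructor <;> intro h <;> linarith
    by_cases hE : E / f = c
    · rw [if_pos hE, if_pos (hiff.1 hE)]
    · have h2 : f - E / c ≠ 0 := fun h => hE (hiff.2 h)
      rw [if_neg hE, if_neg h2]
      congr 1
      have h3 : 1 - E / f / c = (f - E / c) / f := by field_simp
      rw [h3]
      generalize f - E / c = g at *
      field_simp

lemma indI_one {lam c f E : ℝ} (hf : f ≠ 0) (hlam : 0 < lam)
    (h : (E / f) ^ 2 - lam * (E / f) + lam * c ≤ 0) : indI lam c (TT f E) = 1 := by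
  unfold TT
  rw [if_neg hf]
  generalize E / f = b at *
  change (Iset lam c).indicator (fun _ => (1 : ℝ)) b = 1
  apply Set.indicator_of_mem
  unfold Iset
  have h1 : (2 * b - lam) ^ 2 ≤ lam ^ 2 - 4 * lam * c := by nlinarith
  have h2 : 4 * c ≤ lam := by
    have : 0 ≤ lam * (lam - 4 * c) := by nlinarith [sq_nonneg (2 * b - lam)]
    have := nonneg_of_mul_nonneg_right this hlam
    linarith
  rw [if_pos h2]
  have h3 := Real.abs_le_sqrt h1
  rw [abs_le] at h3
  constructor <;> linarith [h3.1, h3.2]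

lemma key {c lam θ f E : ℝ} (hc : 0 < c) (hlam : 0 < lam) (hT : Tan θ = TT f E)
    (hneg : E * (E + lam * (f - E / c)) < 0) (i : ℤ) (h1 : i * Real.pi < θ)
    (h2 : phi c lam θ < (i + 1) * Real.pi) : False := by
  have hE : E ≠ 0 := by rintro rfl; simp at hneg
  obtain ⟨hs1, hs2⟩ := phi_spec c lam θ
  have hle := le_phi c lam θ
  rw [hT, Xi_TT c lam f E hc (Or.inr hE)] at hs2
  rw [hT] at hs1
  generalize phi c lam θ = θ' at *
  set f' := f - E / c with hf'
  set E' := E + lam * f' with hE'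
  have a1 := Tan_add_int θ (-i)
  have a2 := Tan_add_int θ' (-i)
  rw [hT, Tan_eq_TT] at a1
  rw [hs2, Tan_eq_TT] at a2
  push_cast at a1 a2
  have c1 := TT_cross a1
  have c2 := TT_cross a2
  have p1 : 0 < Real.sin (θ + -i * Real.pi) := Real.sin_pos_of_pos_of_lt_pi (by linarith) (by linarith)
  have p2 : 0 < Real.sin (θ' + -i * Real.pi) := Real.sin_pos_of_pos_of_lt_pi (by linarith) (by linarith)
  have p3 : 0 ≤ Real.sin ((θ' + -i * Real.pi) - (θ + -i * Real.pi)) :=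
    Real.sin_nonneg_of_nonneg_of_le_pi (by linarith) (by linarith)
  rw [Real.sin_sub] at p3
  generalize Real.sin (θ + -i * Real.pi) = s at *
  generalize Real.sin (θ' + -i * Real.pi) = s' at *
  generalize Real.cos (θ + -i * Real.pi) = k at *
  generalize Real.cos (θ' + -i * Real.pi) = k' at *
  have q : (s' * k - k' * s) * (E * E') = s * s' * (f * E' - f' * E) := by
    linear_combination s' * E' * c1 - s * E * c2
  have q2 : s * s' * (f * E' - f' * E) ≤ 0 := by
    rw [← q]; exact mul_nonpos_of_nonneg_of_nonpos p3 hneg.le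
  have q3 : f * E' - f' * E ≤ 0 := by
    by_contra hh
    push Not at hh
    have := mul_pos (mul_pos p1 p2) hh
    linarith
  have q4 : lam * c * f ^ 2 - lam * f * E + E ^ 2 ≤ 0 := by
    have : lam * c * f ^ 2 - lam * f * E + E ^ 2 = c * (f * E' - f' * E) := by
      rw [hE', hf']; field_simp; ring
    rw [this]
    exact mul_nonpos_of_nonneg_of_nonpos hc.le q3
  have hf : f ≠ 0 := by
    rintro rfl
    have : 0 < E ^ 2 := by positivity
    nlinarith
  have hI : indI lam c (TT f E) = 1 := by
    apply indI_one hf hlam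
    have : (E / f) ^ 2 - lam * (E / f) + lam * c
        = (lam * c * f ^ 2 - lam * f * E + E ^ 2) / f ^ 2 := by field_simp; ring
    rw [this]
    exact div_nonpos_of_nonpos_of_nonneg q4 (sq_nonneg f)
  rw [hI] at hs1
  linarith

lemma theta_step (c : ℕ → ℝ) (lam : ℝ) (n : ℕ) (hn : 1 ≤ n) :
    thetaSeq c lam (n + 2) = phi (c n) lam (thetaSeq c lam (n + 1)) := by
  obtain ⟨m, rfl⟩ := Nat.exists_eq_add_of_le' hn
  rfl

lemma theta_mono (c : ℕ → ℝ) (lam : ℝ) (hlam : 0 < lam) : Monotone (thetaSeq c lam) := by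
  apply monotone_nat_of_le_succ
  intro n
  match n with
  | 0 => exact le_refl (0 : ℝ)
  | 1 => exact (Real.arctan_pos.2 hlam).le
  | n + 2 => exact le_phi _ _ _

noncomputable def EE (c : ℕ → ℝ) (lam : ℝ) (n : ℕ) : ℝ := c n * (fseq c lam n - fseq c lam (n + 1))

lemma EE_succ (c : ℕ → ℝ) (lam : ℝ) (n : ℕ) (h : 0 < c (n + 1)) :
    EE c lam (n + 1) = EE c lam n + lam * fseq c lam (n + 1) := by
  unfold EE
  rw [show fseq c lam (n + 1 + 1) = fseq c lam (n + 1) +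
      (c (n + 1))⁻¹ * (c n * (fseq c lam (n + 1) - fseq c lam n) - lam * fseq c lam (n + 1)) from rfl]
  field_simp
  ring

lemma f_succ (c : ℕ → ℝ) (lam : ℝ) (n : ℕ) (h : 0 < c n) :
    fseq c lam (n + 1) = fseq c lam n - EE c lam n / c n := by
  unfold EE
  field_simp
  ring

lemma inv (N : ℕ) (c : ℕ → ℝ) (hc : ∀ y, 1 ≤ y → y ≤ N - 1 → 0 < c y) (lam : ℝ) (hlam : 0 < lam)
    (n : ℕ) (hn : 1 ≤ n) (hn' : n ≤ N - 1) :
    Tan (thetaSeq c lam (n + 1)) = TT (fseq c lam n) (EE c lam n) ∧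
      (fseq c lam n ≠ 0 ∨ EE c lam n ≠ 0) := by
  induction n, hn using Nat.le_induction with
  | base =>
    have h1 : fseq c lam 1 = 1 := rfl
    have h2 : EE c lam 1 = lam := by
      rw [EE_succ c lam 0 (hc 1 le_rfl hn'), h1]
      simp [EE, fseq]
    rw [h1, h2]
    refine ⟨?_, Or.inl one_ne_zero⟩
    change Tan (Real.arctan lam) = _
    unfold Tan TT
    rw [if_neg (Real.cos_arctan_pos lam).ne', Real.tan_arctan]
    simp
  | succ n hn ih =>
    obtain ⟨i1, i2⟩ := ih (by omega)
    have hcn := hc n hn (by omega)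
    have hcn1 := hc (n + 1) (by omega) hn'
    constructor
    · rw [theta_step c lam n hn, (phi_spec _ _ _).2, i1, Xi_TT _ _ _ _ hcn i2, EE_succ c lam n hcn1,
        f_succ c lam n hcn]
    · by_contra hh
      push Not at hh
      obtain ⟨g1, g2⟩ := hh
      rw [EE_succ c lam n hcn1, g1] at g2
      have g3 : EE c lam n = 0 := by simpa using g2
      have g4 := f_succ c lam n hcn
      rw [g1, g3] at g4
      have : fseq c lam n = 0 := by simpa using g4.symm
      rcases i2 with h | h
      · exact h this
      · exact h g3

lemma sin_zero_iff {θ f E : ℝ} (hT : Tan θ = TT f E) (h : f ≠ 0 ∨ E ≠ 0) :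
    E = 0 ↔ ∃ n : ℤ, (n : ℝ) * Real.pi = θ := by
  rw [← Real.sin_eq_zero_iff]
  rw [Tan_eq_TT] at hT
  have h1 := TT_cross hT
  constructor
  · intro hE
    subst hE
    have hf : f ≠ 0 := by simpa using h
    rw [mul_zero] at h1
    rcases mul_eq_zero.1 h1.symm with h2 | h2
    · exact absurd h2 hf
    · exact h2
  · intro hs
    rw [hs, mul_zero] at h1
    rcases mul_eq_zero.1 h1 with h2 | h2
    · have := Real.sin_sq_add_cos_sq θ
      rw [hs, h2] at this
      norm_num at this
    · exact h2

/-- abstract form of a local extremum in terms of the differences. -/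
lemma extremum_cases (N : ℕ) (c : ℕ → ℝ) (hc : ∀ y, 1 ≤ y → y ≤ N - 1 → 0 < c y) (lam : ℝ)
    (hlam : 0 < lam) (b c' : ℕ) (h : AdmitsLocalExtremum N (fseq c lam) b c') :
    2 ≤ b ∧ b ≤ c' ∧ c' ≤ N - 1 ∧ EE c lam (b - 1) * EE c lam c' < 0 ∧
      ∀ z, b ≤ z → z < c' → EE c lam z = 0 := by
  have aux : ∀ (_ : 2 ≤ b) (_ : b ≤ c') (_ : c' ≤ N - 1)
      (_ : ∀ x ∈ Finset.Icc b c', fseq c lam x = fseq c lam b), 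
      ∀ z, b ≤ z → z < c' → EE c lam z = 0 := by
    intro h1 h2 h3 h4 z hz1 hz2
    unfold EE
    rw [h4 z (Finset.mem_Icc.2 ⟨hz1, by omega⟩), h4 (z + 1) (Finset.mem_Icc.2 ⟨by omega, by omega⟩)]
    simp
  rcases h with ⟨h1, h2, h3, h4, h5, h6⟩ | ⟨h1, h2, h3, h4, h5, h6⟩
  · refine ⟨h1, h2, h3, ?_, aux h1 h2 h3 h4⟩
    apply mul_neg_of_neg_of_pos
    · unfold EE
      rw [Nat.sub_add_cancel (by omega)]
      exact mul_neg_of_pos_of_neg (hc _ (by omega) (by omega)) (by linarith)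
    · exact mul_pos (hc _ (by omega) (by omega)) (by linarith)
  · refine ⟨h1, h2, h3, ?_, aux h1 h2 h3 h4⟩
    apply mul_neg_of_pos_of_neg
    · unfold EE
      rw [Nat.sub_add_cancel (by omega)]
      exact mul_pos (hc _ (by omega) (by omega)) (by linarith)
    · exact mul_neg_of_pos_of_neg (hc _ (by omega) (by omega)) (by linarith)

/-- Points not among the crossing points `x_i` (nor equal to `x_i − 1` when
`θ(λ,x_i) = iπ`) are not contained in any interval at which `f^λ` admits a
local extremum. -/
theorem non_crossing_points_not_extrema (N : ℕ) (hN : 2 ≤ N) (c : ℕ → ℝ)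
    (hc : ∀ y, 1 ≤ y → y ≤ N - 1 → 0 < c y)
    (k : ℕ) (hk : 1 ≤ k) (hk' : k ≤ N - 1)
    (lam : ℝ) (hlam : 0 < lam)
    (hθN : thetaSeq c lam (N + 1) = (k : ℝ) * Real.pi)
    (x : ℕ → ℕ)
    (hx1 : ∀ i, 1 ≤ i → i ≤ k - 1 → 2 ≤ x i ∧ x i ≤ N - 1)
    (hx2 : ∀ i, 1 ≤ i → i ≤ k - 1 → thetaSeq c lam (x i) ≤ (i : ℝ) * Real.pi)
    (hx3 : ∀ i, 1 ≤ i → i ≤ k - 1 → (i : ℝ) * Real.pi < thetaSeq c lam (x i + 1))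
    (y : ℕ) (hy : 2 ≤ y) (hy' : y ≤ N - 1)
    (hnot : ∀ i, 1 ≤ i → i ≤ k - 1 → y ≠ x i ∧
      (thetaSeq c lam (x i) = (i : ℝ) * Real.pi → y ≠ x i - 1)) :
    ∀ b c', b ≤ y → y ≤ c' → ¬ AdmitsLocalExtremum N (fseq c lam) b c' := by
  intro b c' hb hc' hext
  obtain ⟨e1, e2, e3, e4, e5⟩ := extremum_cases N c hc lam hlam b c' hext
  have hmono := theta_mono c lam hlam
  have hpi := Real.pi_pos
  -- crossing points are determined
  have cross : ∀ (w : ℕ) (i : ℤ), 2 ≤ w → w ≤ N - 1 → thetaSeq c lam w ≤ i * Real.pi →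
      i * Real.pi < thetaSeq c lam (w + 1) →
      ∃ j : ℕ, (j : ℤ) = i ∧ 1 ≤ j ∧ j ≤ k - 1 ∧ x j = w := by
    intro w i hw hw' h1 h2
    have h3 : 0 < thetaSeq c lam w :=
      lt_of_lt_of_le (Real.arctan_pos.2 hlam) (hmono hw : thetaSeq c lam 2 ≤ _)
    have hi0 : 0 < i := by
      have : 0 < (i : ℝ) := pos_of_mul_pos_left (lt_of_lt_of_le h3 h1) hpi.le
      exact_mod_cast this
    have hik : i < k := by
      have h4 : thetaSeq c lam (w + 1) ≤ thetaSeq c lam (N + 1) := hmono (by omega)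
      rw [hθN] at h4
      have : (i : ℝ) < k := lt_of_mul_lt_mul_right (lt_of_lt_of_le h2 h4) hpi.le
      exact_mod_cast this
    obtain ⟨j, rfl⟩ := Int.eq_ofNat_of_zero_le hi0.le
    have j1 : 1 ≤ j := by omega
    have j2 : j ≤ k - 1 := by omega
    refine ⟨j, rfl, j1, j2, ?_⟩
    have g2 := hx2 j j1 j2
    have g3 := hx3 j j1 j2
    push_cast at h1 h2
    rcases lt_trichotomy (x j) w with hlt | heq | hgt
    · have : thetaSeq c lam (x j + 1) ≤ thetaSeq c lam w := hmono hlt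
      linarith
    · exact heq
    · have : thetaSeq c lam (w + 1) ≤ thetaSeq c lam (x j) := hmono hgt
      linarith
  obtain ⟨p, rfl⟩ : ∃ p, b = p + 1 := ⟨b - 1, by omega⟩
  rw [Nat.add_sub_cancel] at e4
  rcases Nat.lt_or_ge (p + 1) c' with hlt | hge
  · -- plateau
    have z1 := e5 (p + 1) le_rfl hlt
    obtain ⟨i1, i2⟩ := inv N c hc lam hlam (p + 1) (by omega) (by omega)
    have hfne : fseq c lam (p + 1) ≠ 0 := by simpa [z1] using i2
    have hE2 : EE c lam (p + 2) ≠ 0 := by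
      rw [EE_succ c lam (p + 1) (hc _ (by omega) (by omega)), 
        f_succ c lam (p + 1) (hc _ (by omega) (by omega)), z1]
      simp [hfne, hlam.ne']
    have hcp : c' = p + 2 := by
      by_contra hne
      exact hE2 (e5 (p + 2) (by omega) (by omega))
    subst hcp
    obtain ⟨k1, k2⟩ := inv N c hc lam hlam (p + 2) (by omega) (by omega)
    obtain ⟨i, hi⟩ := (sin_zero_iff i1 i2).1 z1
    have hlt2 : thetaSeq c lam (p + 2) < thetaSeq c lam (p + 3) := by
      refine lt_of_le_of_ne (hmono (by omega)) ?_
      intro heq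
      exact hE2 ((sin_zero_iff k1 k2).2 ⟨i, by rw [hi]; exact heq⟩)
    obtain ⟨j, j0, j1, j2, j3⟩ := cross (p + 2) i (by omega) (by omega) hi.ge (by rw [hi]; exact hlt2)
    subst j0
    obtain ⟨n1, n2⟩ := hnot j j1 j2
    rw [j3] at n1 n2
    have n3 := n2 (by rw [← Int.cast_natCast j]; exact hi.symm)
    omega
  · have hcp : c' = p + 1 := by omega
    subst hcp
    have hyp : y = p + 1 := by omega
    subst hyp
    obtain ⟨i1, i2⟩ := inv N c hc lam hlam p (by omega) (by omega)
    obtain ⟨k1, k2⟩ := inv N c hc lam hlam (p + 1) (by omega) (by omega)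
    have hp0 := hc p (by omega) (by omega)
    have hE1 : EE c lam (p + 1) ≠ 0 := by intro h; simp [h] at e4
    set i : ℤ := ⌈thetaSeq c lam (p + 1) / Real.pi⌉ with hi
    have hi1 : thetaSeq c lam (p + 1) ≤ i * Real.pi := by
      rw [← div_le_iff₀ hpi]; exact Int.le_ceil _
    have hi2 : ((i - 1 : ℤ) : ℝ) * Real.pi < thetaSeq c lam (p + 1) := by
      rw [← lt_div_iff₀ hpi]
      push_cast
      linarith [Int.ceil_lt_add_one (thetaSeq c lam (p + 1) / Real.pi)]
    by_cases hcr : i * Real.pi < thetaSeq c lam (p + 2)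
    · obtain ⟨j, j0, j1, j2, j3⟩ := cross (p + 1) i (by omega) (by omega) hi1 hcr
      exact (hnot j j1 j2).1 j3.symm
    · push Not at hcr
      have hlt2 : thetaSeq c lam (p + 2) < i * Real.pi := by
        refine lt_of_le_of_ne hcr ?_
        intro heq
        exact hE1 ((sin_zero_iff k1 k2).2 ⟨i, heq.symm⟩)
      rw [theta_step c lam p (by omega)] at hlt2
      rw [EE_succ c lam p (hc _ (by omega) (by omega)), f_succ c lam p hp0] at e4
      exact key hp0 hlam i1 e4 (i - 1) hi2 (by push_cast; linarith)
end
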